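/- Let α > 0 and u_α(x,y,t) = t(x² + y²)^α. On the open set of points ((x,y),t) with t > 0, (x,y) ≠ (0,0) and 2αt(x² + y²)^{α−1/2} < 1, one has H(∇u_α(x,y,t)) = 0 and ∂ₜu_α(x,y,t) = (x² + y²)^α; hence u_α satisfies ∂ₜu_α − div H(∇u_α) = (x² + y²)^α classically on this set. -/

import Mathlib

open Real MeasureTheory

/-- The Euclidean norm on `ℝ × ℝ`. -/
noncomputable def norm2 (v : ℝ × ℝ) : ℝ := Real.sqrt (v.1 ^ 2 + v.2 ^ 2)

/-- The degenerate vector field `H(ξ) = (|ξ| - 1)₊ ξ / |ξ|`, with `H 0 = 0`. -/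
noncomputable def H2 (v : ℝ × ℝ) : ℝ × ℝ :=
  if v = 0 then 0 else (max (norm2 v - 1) 0 / norm2 v) • v

/-- The (spatial) gradient of a function of two real variables. -/
noncomputable def grad2 (f : ℝ → ℝ → ℝ) (x y : ℝ) : ℝ × ℝ :=
  (deriv (fun x' => f x' y) x, deriv (fun y' => f x y') y)

/-- The (spatial) divergence of a planar vector field. -/
noncomputable def div2 (F : ℝ → ℝ → ℝ × ℝ) (x y : ℝ) : ℝ :=
  deriv (fun x' => (F x' y).1) x + deriv (fun y' => (F x y').2) y

theorem H2_eq_zero_of_norm2_le_one {v : ℝ × ℝ} (hv : norm2 v ≤ 1) : H2 v = 0 := by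
  simp [H2, max_eq_right (sub_nonpos.mpr hv)]

theorem grad2_const_mul_rpow (α t : ℝ) {a b : ℝ} (h : a ^ 2 + b ^ 2 ≠ 0) :
    grad2 (fun a b => t * (a ^ 2 + b ^ 2) ^ α) a b =
      (2 * α * t * (a ^ 2 + b ^ 2) ^ (α - 1)) • (a, b) := by
  have ha : HasDerivAt (fun a' : ℝ => t * (a' ^ 2 + b ^ 2) ^ α)
      (t * (2 * a * α * (a ^ 2 + b ^ 2) ^ (α - 1))) a := by
    have h0 : HasDerivAt (fun a' : ℝ => a' ^ 2 + b ^ 2) (2 * a) a := by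
      simpa using (hasDerivAt_pow 2 a).add_const (b ^ 2)
    exact (h0.rpow_const (Or.inl h)).const_mul t
  have hb : HasDerivAt (fun b' : ℝ => t * (a ^ 2 + b' ^ 2) ^ α)
      (t * (2 * b * α * (a ^ 2 + b ^ 2) ^ (α - 1))) b := by
    have h0 : HasDerivAt (fun b' : ℝ => a ^ 2 + b' ^ 2) (2 * b) b := by
      simpa using (hasDerivAt_pow 2 b).const_add (a ^ 2)
    exact (h0.rpow_const (Or.inl h)).const_mul t
  simp only [grad2, ha.deriv, hb.deriv, Prod.smul_mk, smul_eq_mul]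
  ext <;> ring

theorem norm2_grad2_const_mul_rpow {α t : ℝ} (hα : 0 ≤ α) (ht : 0 ≤ t) {a b : ℝ}
    (h : 0 < a ^ 2 + b ^ 2) :
    norm2 (grad2 (fun a b => t * (a ^ 2 + b ^ 2) ^ α) a b) =
      2 * α * t * (a ^ 2 + b ^ 2) ^ (α - 1 / 2) := by
  rw [grad2_const_mul_rpow α t h.ne', norm2]
  have hr : (a ^ 2 + b ^ 2) ^ (α - 1 / 2) =
      (a ^ 2 + b ^ 2) ^ (α - 1) * Real.sqrt (a ^ 2 + b ^ 2) := by
    rw [Real.sqrt_eq_rpow, ← Real.rpow_add h]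
    ring_nf
  have hc : 0 ≤ 2 * α * t * (a ^ 2 + b ^ 2) ^ (α - 1) := by positivity
  simp only [Prod.smul_mk, smul_eq_mul, mul_pow _ a, mul_pow _ b, ← mul_add]
  rw [Real.sqrt_mul (sq_nonneg _), Real.sqrt_sq hc, hr, mul_assoc]

theorem H2_grad2_const_mul_rpow_eq_zero {α t : ℝ} (hα : 0 ≤ α) (ht : 0 ≤ t) {a b : ℝ}
    (h : 0 < a ^ 2 + b ^ 2) (hlt : 2 * α * t * (a ^ 2 + b ^ 2) ^ (α - 1 / 2) < 1) :
    H2 (grad2 (fun a b => t * (a ^ 2 + b ^ 2) ^ α) a b) = 0 :=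
  H2_eq_zero_of_norm2_le_one ((norm2_grad2_const_mul_rpow hα ht h).trans_le hlt.le)

theorem stmt_6 (α : ℝ) (hα : 0 < α) (x y t : ℝ) (ht : 0 < t)
    (hxy : (x, y) ≠ ((0 : ℝ), (0 : ℝ)))
    (hlt : 2 * α * t * (x ^ 2 + y ^ 2) ^ (α - 1 / 2) < 1) :
    H2 (grad2 (fun a b => t * (a ^ 2 + b ^ 2) ^ α) x y) = 0 ∧
    deriv (fun s => s * (x ^ 2 + y ^ 2) ^ α) t = (x ^ 2 + y ^ 2) ^ α ∧
    deriv (fun s => s * (x ^ 2 + y ^ 2) ^ α) t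
        - div2 (fun a b => H2 (grad2 (fun a' b' => t * (a' ^ 2 + b' ^ 2) ^ α) a b)) x y
      = (x ^ 2 + y ^ 2) ^ α := by
  have hr : 0 < x ^ 2 + y ^ 2 := by
    by_contra hle
    exact hxy (Prod.ext (by simp; nlinarith [sq_nonneg x, sq_nonneg y])
      (by simp; nlinarith [sq_nonneg x, sq_nonneg y]))
  have hnear : ∀ g : ℝ → ℝ × ℝ, ∀ s : ℝ, g s = (x, y) → Continuous g →
      (fun s' => H2 (grad2 (fun a b => t * (a ^ 2 + b ^ 2) ^ α) (g s').1 (g s').2))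
        =ᶠ[nhds s] fun _ => 0 := by
    intro g s hg hcont
    have hq : ContinuousAt (fun s' => (g s').1 ^ 2 + (g s').2 ^ 2) s := by fun_prop
    have hpos : 0 < (g s).1 ^ 2 + (g s).2 ^ 2 := by simpa [hg] using hr
    have hp : ContinuousAt
        (fun s' => 2 * α * t * ((g s').1 ^ 2 + (g s').2 ^ 2) ^ (α - 1 / 2)) s :=
      continuousAt_const.mul (hq.rpow_const (Or.inl hpos.ne'))
    filter_upwards [hq.eventually_const_lt hpos,
      hp.eventually_lt_const (by simpa only [hg] using hlt)] with s' h1 h2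
    exact H2_grad2_const_mul_rpow_eq_zero hα.le ht.le h1 h2
  have htime : deriv (fun s => s * (x ^ 2 + y ^ 2) ^ α) t = (x ^ 2 + y ^ 2) ^ α := by
    simp
  have hdiv : div2 (fun a b => H2 (grad2 (fun a' b' => t * (a' ^ 2 + b' ^ 2) ^ α) a b)) x y
      = 0 := by
    have hx := ((hnear (fun a => (a, y)) x rfl (by fun_prop)).fun_comp Prod.fst).deriv_eq
    have hy := ((hnear (fun b => (x, b)) y rfl (by fun_prop)).fun_comp Prod.snd).deriv_eq
    simp only [Function.comp_def, Prod.fst_zero, Prod.snd_zero, deriv_const] at hx hy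
    rw [div2, hx, hy, add_zero]
  exact ⟨H2_grad2_const_mul_rpow_eq_zero hα.le ht.le hr hlt, htime, by rw [htime, hdiv, sub_zero]⟩
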